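/- (Lemma 3: the potential function π_ω is consistent.) Let V be a set of vertices with arc set A ⊆ V × V, weights τ : A → ℝ with τ(u,v) ≥ 0 and c : A → ℝ, battery capacity M > 0, and maximum charging speed c_max > 0. Suppose d_τ, d_c, d_ω : V → ℝ satisfy, for every arc (u,v) ∈ A: d_τ(u) ≤ τ(u,v) + d_τ(v), d_c(u) ≤ c(u,v) + d_c(v), and d_ω(u) ≤ τ(u,v) + c(u,v)/c_max + d_ω(v); and suppose d_ω(v) ≥ d_τ(v) + d_c(v)/c_max for every v ∈ V. Define π_ω(v,b) := d_τ(v) if b ≥ d_c(v), and π_ω(v,b) := d_ω(v) − b/c_max otherwise. Then π_ω is consistent: for every arc (u,v) ∈ A and every b ∈ [0,M] with b ≥ max(0, c(u,v)), one has τ(u,v) − π_ω(u,b) + π_ω(v, min(M, b − c(u,v))) ≥ 0. -/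

import Mathlib

/-- The potential function `π_ω`: for vertex `v` and SoC `b`, it equals the unconstrained
driving-time distance `dτ v` if `b ≥ d_c(v)`, and `dω v − b / cmax` otherwise. -/
noncomputable def omegaPot {V : Type*} (cmax : ℝ) (dτ dc dω : V → ℝ) (v : V) (b : ℝ) : ℝ :=
  if dc v ≤ b then dτ v else dω v - b / cmax

/-- Lemma 3: the potential function `π_ω` is consistent. -/
theorem omegaPot_consistent {V : Type*} (A : Set (V × V)) (τ c : V → V → ℝ)
    (M cmax : ℝ) (hM : 0 < M) (hcmax : 0 < cmax)
    (dτ dc dω : V → ℝ)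
    (hτ : ∀ u v : V, (u, v) ∈ A → 0 ≤ τ u v)
    (htriτ : ∀ u v : V, (u, v) ∈ A → dτ u ≤ τ u v + dτ v)
    (htric : ∀ u v : V, (u, v) ∈ A → dc u ≤ c u v + dc v)
    (htriω : ∀ u v : V, (u, v) ∈ A → dω u ≤ τ u v + c u v / cmax + dω v)
    (hbound : ∀ v : V, dτ v + dc v / cmax ≤ dω v) :
    ∀ u v : V, (u, v) ∈ A → ∀ b : ℝ, 0 ≤ b → b ≤ M → max 0 (c u v) ≤ b →
      0 ≤ τ u v - omegaPot cmax dτ dc dω u b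
            + omegaPot cmax dτ dc dω v (min M (b - c u v)) := by
  intro u v huv b _ _ _
  have h1 := htriτ u v huv
  have h2 := htric u v huv
  have h3 := htriω u v huv
  have h4 := hbound v
  have hb' : min M (b - c u v) ≤ b - c u v := min_le_right _ _
  generalize min M (b - c u v) = b' at hb' ⊢
  have h5 : b' / cmax ≤ b / cmax - c u v / cmax := by
    rw [← sub_div]
    exact div_le_div_of_nonneg_right hb' hcmax.le
  unfold omegaPot
  split_ifs with hu hv hv
  · linarith
  · have h6 : b' / cmax ≤ dc v / cmax :=
      div_le_div_of_nonneg_right (not_le.mp hv).le hcmax.le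
    linarith
  · exact absurd (by linarith) hu
  · linarith
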